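/- arXiv:1312.2324 — 3 statements merged into one kernel-verified Lean document; each statement's English description precedes it below -/
import Mathlib

section
/- Let d ∈ ℕ, k ≥ 1, let f : ℝᵈ → ℝ be k-times continuously differentiable, and let u₀, u₁, …, u_{k−1} ∈ ℝᵈ. For a vector v ∈ ℝᵈ define [f]_k(v) := (1/k!) · (dᵏ/dεᵏ)|_{ε=0} of the function ε ↦ f(u₀ + Σ_{j=1}^{k−1} ε^j u_j + ε^k v). Then the quantity [f]_k(v) − Σ_{i=1}^{d} ∂_i f(u₀) v_i is independent of v; that is, for all v, w ∈ ℝᵈ: [f]_k(v) − Σ_{i=1}^{d} ∂_i f(u₀) v_i = [f]_k(w) − Σ_{i=1}^{d} ∂_i f(u₀) w_i. (In other words, the k-th Taylor coefficient in ε of f evaluated along the expansion depends on the k-th expansion coefficient only through the linear term Σ_i ∂_i f(u₀) v_i, the remaining part depending only on u₀, …, u_{k−1}.) -/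
open scoped BigOperators

open Filter Asymptotics Topology

/-- If `h` is `C^n` and `h x = o((x - x₀) ^ n)` at `x₀`, then its `n`-th derivative vanishes
at `x₀`. -/
theorem iteratedDeriv_eq_zero_of_isLittleO_pow {E : Type*} [NormedAddCommGroup E]
    [NormedSpace ℝ E] {h : ℝ → E} {x₀ : ℝ} {n : ℕ} (hc : ContDiff ℝ n h)
    (ho : h =o[𝓝 x₀] fun x => (x - x₀) ^ n) : iteratedDeriv n h x₀ = 0 := by
  induction n using Nat.strong_induction_on with
  | _ n ih =>
    have hlow : ∀ m < n, iteratedDeriv m h x₀ = 0 := fun m hm => by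
      refine ih m hm (hc.of_le (by exact_mod_cast hm.le)) (ho.trans_isBigO ?_)
      have hpow : (fun x : ℝ => x ^ n) =O[𝓝 0] fun x => x ^ m := (isLittleO_pow_pow hm).isBigO
      exact hpow.comp_tendsto (tendsto_sub_nhds_zero_iff.mpr tendsto_id)
    have htaylor := ho.sub (taylor_isLittleO_univ (x₀ := x₀) hc)
    simp only [sub_sub_cancel, taylor_within_apply, iteratedDerivWithin_univ,
      Finset.sum_range_succ] at htaylor
    have hsum (x : ℝ) : ∑ m ∈ Finset.range n,
        ((m.factorial : ℝ)⁻¹ * (x - x₀) ^ m) • iteratedDeriv m h x₀ = 0 :=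
      Finset.sum_eq_zero fun m hm => by rw [hlow m (Finset.mem_range.mp hm), smul_zero]
    simp only [hsum, zero_add] at htaylor
    by_contra hne
    have hfac : (n.factorial : ℝ)⁻¹ ≠ 0 := inv_ne_zero (by exact_mod_cast n.factorial_ne_zero)
    have hself : (fun x : ℝ => (x - x₀) ^ n) =o[𝓝 x₀] fun x => (x - x₀) ^ n := by
      refine IsBigO.trans_isLittleO ?_ htaylor
      refine IsBigO.of_bound (‖(n.factorial : ℝ)⁻¹‖ * ‖iteratedDeriv n h x₀‖)⁻¹
        (Eventually.of_forall fun x => le_of_eq ?_)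
      have hnorm := norm_ne_zero_iff.mpr hne
      have hnorm_fac := norm_ne_zero_iff.mpr hfac
      rw [norm_smul, norm_mul]
      generalize ‖(n.factorial : ℝ)⁻¹‖ = a at *
      field_simp
    refine isLittleO_irrefl ?_ hself
    have heventually : ∀ᶠ x in 𝓝[≠] x₀, (x - x₀) ^ n ≠ 0 :=
      eventually_mem_nhdsWithin.mono fun x hx => pow_ne_zero n (sub_ne_zero.mpr hx)
    exact heventually.frequently.filter_mono nhdsWithin_le_nhds

/-- Perturbing a curve `c` by `ε ^ k • v` changes the `k`-th derivative of `f ∘ c` at `0`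
by `k!` times the derivative of `f` at `c 0` in the direction `v`. -/
theorem iteratedDeriv_comp_add_pow_smul {E F : Type*} [NormedAddCommGroup E] [NormedSpace ℝ E]
    [NormedAddCommGroup F] [NormedSpace ℝ F] {f : E → F} {c : ℝ → E} {k : ℕ} (hk : k ≠ 0)
    (hf : ContDiff ℝ k f) (hc : ContDiff ℝ k c) (v : E) :
    iteratedDeriv k (fun ε : ℝ => f (c ε + ε ^ k • v)) 0 =
      iteratedDeriv k (fun ε : ℝ => f (c ε)) 0 + (k.factorial : ℝ) • fderiv ℝ f (c 0) v := by
  have hpow : ContDiff ℝ k fun ε : ℝ => ε ^ k := contDiff_id.pow k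
  have hpert : ContDiff ℝ k fun ε : ℝ => f (c ε + ε ^ k • v) :=
    hf.comp (hc.add (hpow.smul contDiff_const))
  have hbase : ContDiff ℝ k fun ε : ℝ => f (c ε) := hf.comp hc
  have hlin : ContDiff ℝ k fun ε : ℝ => ε ^ k • fderiv ℝ f (c 0) v := hpow.smul contDiff_const
  have hstrict := hf.hasStrictFDerivAt (x := c 0) (by exact_mod_cast hk)
  have htendsto : Tendsto (fun ε : ℝ => (c ε + ε ^ k • v, c ε)) (𝓝 0) (𝓝 (c 0, c 0)) := by
    have hcont : Continuous fun ε : ℝ => (c ε + ε ^ k • v, c ε) := by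
      have := hc.continuous
      fun_prop
    simpa [hk] using hcont.tendsto 0
  have hlittle : (fun ε : ℝ => f (c ε + ε ^ k • v) - f (c ε) - ε ^ k • fderiv ℝ f (c 0) v)
      =o[𝓝 0] fun ε : ℝ => (ε - 0) ^ k := by
    have hremainder := hstrict.isLittleO.comp_tendsto htendsto
    simp only [Function.comp_def, add_sub_cancel_left, map_smul] at hremainder
    refine hremainder.trans_isBigO (IsBigO.of_bound ‖v‖ (Eventually.of_forall fun ε => ?_))
    rw [norm_smul, sub_zero, mul_comm]
  have hzero := iteratedDeriv_eq_zero_of_isLittleO_pow ((hpert.sub hbase).sub hlin) hlittle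
  rw [iteratedDeriv_fun_sub (hpert.sub hbase).contDiffAt hlin.contDiffAt,
    iteratedDeriv_fun_sub hpert.contDiffAt hbase.contDiffAt] at hzero
  have hmonomial : iteratedDeriv k (fun ε : ℝ => ε ^ k • fderiv ℝ f (c 0) v) 0 =
      (k.factorial : ℝ) • fderiv ℝ f (c 0) v := by
    rw [iteratedDeriv_smul_const hpow.contDiffAt, iteratedDeriv_fun_pow_zero, if_pos rfl]
  rw [hmonomial, sub_sub, sub_eq_zero] at hzero
  exact hzero

/-- The `k`-th Taylor coefficient `[f]_k(v) = (1/k!) (d^k/dε^k)|_{ε=0} f(u₀ + Σ_{j=1}^{k-1} ε^j u_j + ε^k v)`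
depends on `v` only through the linear term `Σ_i ∂_i f(u₀) v_i`: the difference
`[f]_k(v) − Σ_i ∂_i f(u₀) v_i` is independent of `v`.  Here `u : Fin k → ℝᵈ` encodes
the vectors `u₀, u₁, …, u_{k−1}` (so `u ⟨0, _⟩ = u₀`), and the curve is
`ε ↦ Σ_{j=0}^{k-1} ε^j u_j + ε^k v`. -/
theorem kth_coefficient_linear_in_top_order (d k : ℕ) (hk : 1 ≤ k)
    (f : EuclideanSpace ℝ (Fin d) → ℝ) (hf : ContDiff ℝ (k : ℕ) f)
    (u : Fin k → EuclideanSpace ℝ (Fin d))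
    (v w : EuclideanSpace ℝ (Fin d)) :
    ((k.factorial : ℝ))⁻¹ *
        iteratedDeriv k (fun ε : ℝ => f ((∑ j : Fin k, ε ^ (j : ℕ) • u j) + ε ^ k • v)) 0
      - ∑ i, fderiv ℝ f (u ⟨0, hk⟩) (EuclideanSpace.single i 1) * v i
    = ((k.factorial : ℝ))⁻¹ *
        iteratedDeriv k (fun ε : ℝ => f ((∑ j : Fin k, ε ^ (j : ℕ) • u j) + ε ^ k • w)) 0
      - ∑ i, fderiv ℝ f (u ⟨0, hk⟩) (EuclideanSpace.single i 1) * w i := by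
  have hfac : (k.factorial : ℝ) ≠ 0 := by exact_mod_cast k.factorial_ne_zero
  have hk0 : k ≠ 0 := Nat.one_le_iff_ne_zero.mp hk
  have hcurve : ContDiff ℝ k fun ε : ℝ => ∑ j : Fin k, ε ^ (j : ℕ) • u j :=
    ContDiff.sum fun j _ => (contDiff_id.pow _).smul contDiff_const
  have hstart : ∑ j : Fin k, (0 : ℝ) ^ (j : ℕ) • u j = u ⟨0, hk⟩ := by
    rw [Finset.sum_eq_single ⟨0, hk⟩]
    · simp
    · intro j _ hj
      rw [zero_pow fun h => hj (Fin.ext h), zero_smul]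
    · simp
  have hgrad (x : EuclideanSpace ℝ (Fin d)) :
      ∑ i, fderiv ℝ f (u ⟨0, hk⟩) (EuclideanSpace.single i 1) * x i =
        fderiv ℝ f (u ⟨0, hk⟩) x := by
    conv_rhs => rw [← (EuclideanSpace.basisFun (Fin d) ℝ).sum_repr x]
    simp [mul_comm]
  have hcoeff (x : EuclideanSpace ℝ (Fin d)) :=
    iteratedDeriv_comp_add_pow_smul hk0 hf hcurve x
  simp only [hstart, smul_eq_mul] at hcoeff
  rw [hgrad, hgrad, hcoeff, hcoeff, mul_add, mul_add, inv_mul_cancel_left₀ hfac,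
    inv_mul_cancel_left₀ hfac, add_sub_cancel_right, add_sub_cancel_right]
end

section
/- Let d ∈ ℕ, k ∈ ℕ, M, R, ε₀ > 0, and let β : ℝᵈ → ℝᵈ be (k+1)-times continuously differentiable with ‖D^α β(x)‖ ≤ M for all x ∈ ℝᵈ and all multi-indices α with 1 ≤ |α| ≤ k+1. For y₀, …, y_k ∈ ℝᵈ define β_j(y₀,…,y_k) := (1/j!) · (dʲ/dεʲ)|_{ε=0} of ε ↦ β(y₀ + ε y₁ + ⋯ + ε^k y_k), for 0 ≤ j ≤ k. Then there exists a constant C_{k+1} > 0, depending only on k, d, M, R, ε₀, such that for all ε ∈ (0,ε₀], all y₀, …, y_k ∈ ℝᵈ with |y_j| ≤ R for every j, and all y ∈ ℝᵈ with |y| ≤ R: ε^{−(k+1)} · | β( Σ_{j=0}^{k} ε^j y_j + ε^{k+1} y ) − Σ_{j=0}^{k} ε^j β_j(y₀,…,y_k) | ≤ C_{k+1}. -/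
open scoped BigOperators

/-- The `j`-th Taylor coefficient in `ε` (at `ε = 0`) of `ε ↦ g(ε, Σ_{l=0}^k ε^l y_l)`:
`(1/j!) (d^j/dε^j)|_{ε=0} g(ε, y₀ + ε y₁ + ⋯ + ε^k y_k)`. -/
noncomputable def coeffAt {E F : Type*} [NormedAddCommGroup E] [NormedSpace ℝ E]
    [NormedAddCommGroup F] [NormedSpace ℝ F] (k : ℕ)
    (g : ℝ → E → F) (y : Fin (k + 1) → E) (j : ℕ) : F :=
  ((j.factorial : ℝ))⁻¹ • iteratedDeriv j (fun e : ℝ => g e (∑ l : Fin (k + 1), e ^ (l : ℕ) • y l)) 0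

section TaylorRemainder

variable {E F : Type*} [NormedAddCommGroup E] [NormedSpace ℝ E]
  [NormedAddCommGroup F] [NormedSpace ℝ F]

theorem contDiff_sum_pow_smul {n : WithTop ℕ∞} {m : ℕ} (y : Fin m → E) :
    ContDiff ℝ n (fun e : ℝ => ∑ l : Fin m, e ^ (l : ℕ) • y l) := by
  fun_prop

theorem norm_iteratedDeriv_sum_pow_smul_le {m i : ℕ} {R r x : ℝ} (hi : i ≤ m)
    (hx : x ∈ Set.Icc 0 r) (y : Fin m → E) (hy : ∀ j, ‖y j‖ ≤ R) :
    ‖iteratedDeriv i (fun e : ℝ => ∑ l : Fin m, e ^ (l : ℕ) • y l) x‖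
      ≤ m * ((m : ℝ) ^ m * (1 + r) ^ m * R) := by
  obtain ⟨hx0, hxr⟩ := hx
  rw [iteratedDeriv_fun_sum (fun l _ => by fun_prop)]
  refine (norm_sum_le_of_le (f := fun l : Fin m => iteratedDeriv i (fun e : ℝ => e ^ (l : ℕ) • y l) x)
    Finset.univ (n := fun _ => (m : ℝ) ^ m * (1 + r) ^ m * R) fun l _ => ?_).trans (by simp)
  have hm : 1 ≤ m := l.pos
  have h1 : ((l : ℕ).descFactorial i : ℝ) ≤ (m : ℝ) ^ m := by
    exact_mod_cast (Nat.descFactorial_le_pow l i).trans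
      ((Nat.pow_le_pow_left l.isLt.le i).trans (Nat.pow_le_pow_right hm hi))
  have h2 : x ^ ((l : ℕ) - i) ≤ (1 + r) ^ m :=
    (pow_le_pow_left₀ hx0 (by linarith) _).trans
      (pow_le_pow_right₀ (by linarith) (by have := l.isLt; omega))
  rw [iteratedDeriv_smul_const (by fun_prop), iteratedDeriv_pow, norm_smul, Real.norm_of_nonneg
    (by positivity)]
  have : 0 ≤ r := hx0.trans hxr
  gcongr
  exact hy l

theorem iteratedFDeriv_sub_const_apply {h : E → F} {i : ℕ} (c : F) (z : E) (hi : 1 ≤ i)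
    (hh : ContDiff ℝ i h) :
    iteratedFDeriv ℝ i (h - fun _ => c) z = iteratedFDeriv ℝ i h z := by
  rw [iteratedFDeriv_sub_apply hh.contDiffAt contDiffAt_const,
    iteratedFDeriv_const_of_ne (by omega), Pi.zero_apply, sub_zero]

/-- A bound on an iterated derivative of a composition which, unlike
`norm_iteratedFDeriv_comp_le`, does not require a bound on the outer function itself. -/
theorem norm_iteratedFDeriv_comp_le_of_one_le {G : Type*} [NormedAddCommGroup G] [NormedSpace ℝ G]
    {g : F → G} {f : E → F} {n : ℕ} (hn : 1 ≤ n) (hg : ContDiff ℝ n g) (hf : ContDiff ℝ n f)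
    (x : E) {C D : ℝ} (hC0 : 0 ≤ C)
    (hC : ∀ i, 1 ≤ i → i ≤ n → ‖iteratedFDeriv ℝ i g (f x)‖ ≤ C)
    (hD : ∀ i, 1 ≤ i → i ≤ n → ‖iteratedFDeriv ℝ i f x‖ ≤ D ^ i) :
    ‖iteratedFDeriv ℝ n (g ∘ f) x‖ ≤ n.factorial * C * D ^ n := by
  rw [← iteratedFDeriv_sub_const_apply (g (f x)) x hn (hg.comp hf)]
  have hgs : ContDiff ℝ n (g - fun _ => g (f x)) := hg.sub contDiff_const
  have hCs : ∀ i, i ≤ n → ‖iteratedFDeriv ℝ i (g - fun _ => g (f x)) (f x)‖ ≤ C := by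
    intro i hi
    rcases Nat.eq_zero_or_pos i with rfl | hi0
    · simpa using hC0
    · rw [iteratedFDeriv_sub_const_apply _ _ hi0 (hg.of_le (by exact_mod_cast hi))]
      exact hC i hi0 hi
  exact norm_iteratedFDeriv_comp_le hgs hf le_rfl x hCs hD

theorem norm_sub_sum_iteratedDeriv_le {f : ℝ → E} {k : ℕ} {r C : ℝ} (hr : 0 < r)
    (hf : ContDiff ℝ (k + 1 : ℕ) f)
    (hC : ∀ x ∈ Set.Icc 0 r, ‖iteratedDeriv (k + 1) f x‖ ≤ C) {x : ℝ} (hx : x ∈ Set.Icc 0 r) :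
    ‖f x - ∑ j : Fin (k + 1), x ^ (j : ℕ) • (((j : ℕ).factorial : ℝ)⁻¹ • iteratedDeriv j f 0)‖
      ≤ C * x ^ (k + 1) / k.factorial := by
  have hw : ∀ j ≤ k + 1, ∀ z ∈ Set.Icc 0 r,
      iteratedDerivWithin j f (Set.Icc 0 r) z = iteratedDeriv j f z := fun j hj z hz =>
    iteratedDerivWithin_eq_iteratedDeriv (uniqueDiffOn_Icc hr)
      (hf.of_le (by exact_mod_cast hj)).contDiffAt hz
  have h := taylor_mean_remainder_bound (n := k) hr.le (by exact_mod_cast hf.contDiffOn) hx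
    (fun z hz => by rw [hw _ le_rfl z hz]; exact hC z hz)
  rw [taylor_within_apply, Finset.sum_range, sub_zero] at h
  convert h using 4 with j
  rw [hw j (by omega) 0 ⟨le_rfl, hr.le⟩, smul_smul, mul_comm]

end TaylorRemainder

/-- Uniform bound on the normalized Taylor remainder `A^β_{k+1}`: there is a constant
`C_{k+1}`, depending only on `k, d, M, R, ε₀`, bounding
`ε^{-(k+1)} |β(Σ_{j=0}^k ε^j y_j + ε^{k+1} y) − Σ_{j=0}^k ε^j β_j(y₀,…,y_k)|`
uniformly over `ε ∈ (0,ε₀]`, `|y_j| ≤ R`, `|y| ≤ R`, for every `β` which is `C^{k+1}`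
with all derivatives of orders `1,…,k+1` bounded by `M`. -/
theorem remainder_bound_for_beta (d k : ℕ) (M R ε₀ : ℝ) (hM : 0 < M) (hR : 0 < R)
    (hε₀ : 0 < ε₀) :
    ∃ C > 0, ∀ β : EuclideanSpace ℝ (Fin d) → EuclideanSpace ℝ (Fin d),
      ContDiff ℝ (k + 1 : ℕ) β →
      (∀ x, ∀ j : ℕ, 1 ≤ j → j ≤ k + 1 → ‖iteratedFDeriv ℝ j β x‖ ≤ M) →
      ∀ ε ∈ Set.Ioc (0:ℝ) ε₀, ∀ y : Fin (k + 1) → EuclideanSpace ℝ (Fin d),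
        (∀ j, ‖y j‖ ≤ R) → ∀ z : EuclideanSpace ℝ (Fin d), ‖z‖ ≤ R →
        (ε ^ (k + 1))⁻¹ *
            ‖β ((∑ j : Fin (k + 1), ε ^ (j : ℕ) • y j) + ε ^ (k + 1) • z)
              - ∑ j : Fin (k + 1), ε ^ (j : ℕ) • coeffAt k (fun _ x => β x) y (j : ℕ)‖
          ≤ C := by
  set B : ℝ := ((k + 1 : ℕ) : ℝ) * (((k + 1 : ℕ) : ℝ) ^ (k + 1) * (1 + ε₀) ^ (k + 1) * R)
  have hB0 : 0 ≤ B := by positivity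
  set K : ℝ := (k + 1).factorial * M * (1 + B) ^ (k + 1)
  refine ⟨M * R + K / k.factorial, by positivity, ?_⟩
  intro β hβ hder ε hε y hy z hz
  have hε0 : 0 < ε := hε.1
  set φ : ℝ → EuclideanSpace ℝ (Fin d) := fun e => ∑ l : Fin (k + 1), e ^ (l : ℕ) • y l
  have hφs : ContDiff ℝ (k + 1 : ℕ) φ := contDiff_sum_pow_smul y
  have hderiv : ∀ x ∈ Set.Icc 0 ε₀, ‖iteratedDeriv (k + 1) (β ∘ φ) x‖ ≤ K := by
    intro x hx
    rw [← norm_iteratedFDeriv_eq_norm_iteratedDeriv]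
    refine norm_iteratedFDeriv_comp_le_of_one_le (by omega) hβ hφs x hM.le
      (fun i h1 h2 => hder _ i h1 h2) fun i h1 h2 => ?_
    rw [norm_iteratedFDeriv_eq_norm_iteratedDeriv]
    calc _ ≤ B := norm_iteratedDeriv_sum_pow_smul_le h2 hx y hy
      _ ≤ 1 + B := by linarith
      _ ≤ (1 + B) ^ i := le_self_pow₀ (by linarith) (by omega)
  have htaylor := norm_sub_sum_iteratedDeriv_le hε₀ (hβ.comp hφs) hderiv ⟨hε0.le, hε.2⟩
  have hlip : ‖β (φ ε + ε ^ (k + 1) • z) - β (φ ε)‖ ≤ M * (ε ^ (k + 1) * R) := by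
    have h := convex_univ.norm_image_sub_le_of_norm_fderiv_le (𝕜 := ℝ) (f := β) (C := M)
      (fun x _ => (hβ.differentiable (by simp)).differentiableAt)
      (fun x _ => by
        rw [← norm_iteratedFDeriv_one]
        exact hder x 1 le_rfl (by omega))
      (Set.mem_univ (φ ε)) (Set.mem_univ (φ ε + ε ^ (k + 1) • z))
    refine h.trans ?_
    rw [add_sub_cancel_left, norm_smul, Real.norm_of_nonneg (by positivity)]
    gcongr
  rw [inv_mul_le_iff₀ (by positivity)]
  refine (norm_sub_le_norm_sub_add_norm_sub _ (β (φ ε)) _).trans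
    ((add_le_add hlip htaylor).trans_eq ?_)
  ring
end

section
/- Let d, k ∈ ℕ, T > 0, ε₀ > 0, u⁰ ∈ ℝᵈ, and let η₁, …, η_d be finite signed measures on [0,T]. Let β : ℝᵈ → ℝᵈ and σ : ℝ × ℝᵈ → ℝ^{d×d} be (k+1)-times continuously differentiable (σ jointly in (ε,x)). For y₀,…,y_k ∈ ℝᵈ define β_j(y₀,…,y_k) := (1/j!)(dʲ/dεʲ)|_{ε=0} β(Σ_{l=0}^{k} ε^l y_l), σ_j(y₀,…,y_k) := (1/j!)(dʲ/dεʲ)|_{ε=0} σ(ε, Σ_{l=0}^{k} ε^l y_l), and for ε > 0, y ∈ ℝᵈ define A^β_{k+1}(y₀,…,y_k,y;ε) := ε^{−(k+1)} [ β(Σ_{j=0}^{k} ε^j y_j + ε^{k+1} y) − Σ_{j=0}^{k} ε^j β_j(y₀,…,y_k) ] and A^σ_{k+1}(y₀,…,y_k,y;ε) := ε^{−(k+1)} [ σ(ε, Σ_{j=0}^{k} ε^j y_j + ε^{k+1} y) − Σ_{j=0}^{k} ε^j σ_j(y₀,…,y_k) ]. Suppose u_ε : [0,T] → ℝᵈ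 is bounded Borel measurable and satisfies u_ε(t)_l = u⁰_l + ∫₀ᵗ β_l(u_ε(s)) ds + Σ_{j'=1}^{d} ∫_{[0,t]} σ(ε,u_ε(s))_{l j'} dη_{j'}(s) for all t, l, and that bounded Borel measurable u₀,…,u_k : [0,T] → ℝᵈ satisfy, for every 0 ≤ j ≤ k: u_j(t)_l = δ_{j,0} u⁰_l + ∫₀ᵗ β_j(u₀(s),…,u_k(s))_l ds + Σ_{j'=1}^{d} ∫_{[0,t]} σ_j(u₀(s),…,u_k(s))_{l j'} dη_{j'}(s). Define R_k(t,ε) := ε^{−(k+1)} ( u_ε(t) − Σ_{j=0}^{k} ε^j u_j(t) ). Then for every ε ∈ (0,ε₀], t ∈ [0,T] and l: R_k(t,ε)_l = ∫₀ᵗ A^β_{k+1}(u₀(s),…,u_k(s),R_k(s,ε);ε)_l ds + Σ_{j'=1}^{d} ∫_{[0,t]} A^σ_{k+1}(u₀(s),…,u_k(s),R_k(s,ε);ε)_{l j'} dη_{j'}(s). -/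
open scoped BigOperators
open MeasureTheory

/-- The integral `∫_{[0,t]} g dη` of `g` over `[0,t]` with respect to the finite signed
measure `η`, defined as the difference of the integrals with respect to the positive and
negative parts of the Jordan decomposition of `η`. -/
noncomputable def sInt (η : MeasureTheory.SignedMeasure ℝ) (t : ℝ) (g : ℝ → ℝ) : ℝ :=
  (∫ s in Set.Icc (0:ℝ) t, g s ∂η.toJordanDecomposition.posPart)
    - ∫ s in Set.Icc (0:ℝ) t, g s ∂η.toJordanDecomposition.negPart

/-- The normalized Taylor remainder coefficient
`A_{k+1}(y₀,…,y_k,z;ε) = ε^{-(k+1)} [g(ε, Σ_{j=0}^k ε^j y_j + ε^{k+1} z) − Σ_{j=0}^k ε^j g_j(y₀,…,y_k)]`. -/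
noncomputable def remCoeff {E F : Type*} [NormedAddCommGroup E] [NormedSpace ℝ E]
    [NormedAddCommGroup F] [NormedSpace ℝ F] (k : ℕ)
    (g : ℝ → E → F) (y : Fin (k + 1) → E) (z : E) (ε : ℝ) : F :=
  (ε ^ (k + 1))⁻¹ •
    (g ε ((∑ j : Fin (k + 1), ε ^ (j : ℕ) • y j) + ε ^ (k + 1) • z)
      - ∑ j : Fin (k + 1), ε ^ (j : ℕ) • coeffAt k g y (j : ℕ))

/-- Iterated derivatives in the last variable of a jointly `C^(m + j)` map are jointly `C^m`. -/
theorem contDiff_iteratedDeriv_right {V F : Type*} [NormedAddCommGroup V] [NormedSpace ℝ V]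
    [NormedAddCommGroup F] [NormedSpace ℝ F] {G : V → ℝ → F} (j : ℕ) :
    ∀ m : ℕ, ContDiff ℝ (m + j : ℕ) (Function.uncurry G) →
      ContDiff ℝ m (fun p : V × ℝ => iteratedDeriv j (G p.1) p.2) := by
  induction j with
  | zero =>
    intro m h
    simp only [iteratedDeriv_zero]
    exact h
  | succ j ih =>
    intro m h
    have h' := ih (m + 1) (by rwa [add_right_comm, add_assoc])
    simp only [iteratedDeriv_succ, ← fderiv_apply_one_eq_deriv]
    refine ContDiff.clm_apply ?_ contDiff_const
    refine ContDiff.fderiv (𝕜 := ℝ) (f := fun (p : V × ℝ) x => iteratedDeriv j (G p.1) x)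
      (n := m) (m := (m + 1 : ℕ)) ?_ contDiff_snd (by norm_cast)
    exact h'.comp (contDiff_fst.fst.prodMk contDiff_snd)

theorem continuous_coeffAt {E F : Type*} [NormedAddCommGroup E] [NormedSpace ℝ E]
    [NormedAddCommGroup F] [NormedSpace ℝ F] {k n j : ℕ} {g : ℝ → E → F}
    (hg : ContDiff ℝ n (fun p : ℝ × E => g p.1 p.2)) (hj : j ≤ n) :
    Continuous (fun y : Fin (k + 1) → E => coeffAt k g y j) := by
  have hG : ContDiff ℝ n (Function.uncurry
      (fun (y : Fin (k + 1) → E) (e : ℝ) => g e (∑ l : Fin (k + 1), e ^ (l : ℕ) • y l))) := by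
    have hpoly : ContDiff ℝ n (fun p : (Fin (k + 1) → E) × ℝ =>
        ∑ l : Fin (k + 1), p.2 ^ (l : ℕ) • p.1 l) := by
      fun_prop
    exact hg.comp (contDiff_snd.prodMk hpoly)
  have h := contDiff_iteratedDeriv_right j 0
    (hG.of_le (by rw [zero_add]; exact_mod_cast hj))
  exact (h.continuous.comp (Continuous.prodMk_left (0 : ℝ))).const_smul _

/-- A continuous function of a bounded measurable map is integrable on `[0,t]`. -/
theorem Continuous.integrableOn_Icc_comp {V : Type*} [NormedAddCommGroup V]
    [ProperSpace V] [MeasurableSpace V] [BorelSpace V]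
    {φ : V → ℝ} (hφ : Continuous φ) {v : ℝ → V} (hv : Measurable v) {C t : ℝ}
    (hC : ∀ s ∈ Set.Icc (0:ℝ) t, ‖v s‖ ≤ C) (μ : Measure ℝ) [IsLocallyFiniteMeasure μ] :
    IntegrableOn (fun s => φ (v s)) (Set.Icc 0 t) μ := by
  obtain ⟨M, hM⟩ := (isCompact_closedBall (0 : V) C).exists_bound_of_continuousOn
    hφ.continuousOn
  refine Measure.integrableOn_of_bounded (M := M) isCompact_Icc.measure_lt_top.ne
    (hφ.measurable.comp hv).aestronglyMeasurable ?_
  filter_upwards [ae_restrict_mem measurableSet_Icc] with s hs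
  exact hM _ (by simpa using hC s hs)

theorem integral_mul_sub_sum {α ι : Type*} [MeasurableSpace α] [Fintype ι] {μ : Measure α}
    {f : α → ℝ} {g : ι → α → ℝ} (c : ℝ) (a : ι → ℝ) (hf : Integrable f μ)
    (hg : ∀ i, Integrable (g i) μ) :
    ∫ s, c * (f s - ∑ i, a i * g i s) ∂μ
      = c * (∫ s, f s ∂μ - ∑ i, a i * ∫ s, g i s ∂μ) := by
  rw [integral_const_mul, integral_sub hf (integrable_finsetSum _ fun i _ => (hg i).const_mul _),
    integral_finsetSum _ fun i _ => (hg i).const_mul _]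
  simp only [integral_const_mul]

theorem sInt_mul_sub_sum {ι : Type*} [Fintype ι] (η : SignedMeasure ℝ) (t : ℝ)
    {f : ℝ → ℝ} {g : ι → ℝ → ℝ} (c : ℝ) (a : ι → ℝ)
    (hf : ∀ (μ : Measure ℝ) [IsFiniteMeasure μ], IntegrableOn f (Set.Icc 0 t) μ)
    (hg : ∀ i, ∀ (μ : Measure ℝ) [IsFiniteMeasure μ], IntegrableOn (g i) (Set.Icc 0 t) μ) :
    sInt η t (fun s => c * (f s - ∑ i, a i * g i s))
      = c * (sInt η t f - ∑ i, a i * sInt η t (g i)) := by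
  unfold sInt
  rw [integral_mul_sub_sum c a (hf _) fun i => hg i _,
    integral_mul_sub_sum c a (hf _) fun i => hg i _]
  simp only [mul_sub, Finset.sum_sub_distrib]
  ring

theorem remCoeff_eq {E F : Type*} [NormedAddCommGroup E] [NormedSpace ℝ E]
    [NormedAddCommGroup F] [NormedSpace ℝ F] (k : ℕ) (g : ℝ → E → F) (y : Fin (k + 1) → E)
    (x : E) {ε : ℝ} (hε : ε ≠ 0) :
    remCoeff k g y ((ε ^ (k + 1))⁻¹ • (x - ∑ j : Fin (k + 1), ε ^ (j : ℕ) • y j)) ε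
      = (ε ^ (k + 1))⁻¹ • (g ε x - ∑ j : Fin (k + 1), ε ^ (j : ℕ) • coeffAt k g y (j : ℕ)) := by
  rw [remCoeff, smul_inv_smul₀ (pow_ne_zero _ hε), add_sub_cancel]

/-- The normalized remainder `R_k(t,ε) = ε^{-(k+1)}(u_ε(t) − Σ_{j=0}^k ε^j u_j(t))`
itself satisfies the driven integral equation with the Taylor-remainder coefficients
`A^β_{k+1}` and `A^σ_{k+1}`. -/
theorem remainder_satisfies_integral_equation (d k : ℕ) (T ε₀ : ℝ) (hT : 0 < T)
    (hε₀ : 0 < ε₀)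
    (u0 : EuclideanSpace ℝ (Fin d)) (η : Fin d → MeasureTheory.SignedMeasure ℝ)
    (β : EuclideanSpace ℝ (Fin d) → EuclideanSpace ℝ (Fin d))
    (hβ : ContDiff ℝ (k + 1 : ℕ) β)
    (σ : ℝ → EuclideanSpace ℝ (Fin d) → Fin d → Fin d → ℝ)
    (hσ : ContDiff ℝ (k + 1 : ℕ) (fun p : ℝ × EuclideanSpace ℝ (Fin d) => σ p.1 p.2))
    (uε : ℝ → ℝ → EuclideanSpace ℝ (Fin d))
    (huεm : ∀ ε ∈ Set.Ioc (0:ℝ) ε₀, Measurable (uε ε))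
    (K : ℝ) (huεb : ∀ ε ∈ Set.Ioc (0:ℝ) ε₀, ∀ t ∈ Set.Icc (0:ℝ) T, ‖uε ε t‖ ≤ K)
    (huε : ∀ ε ∈ Set.Ioc (0:ℝ) ε₀, ∀ t ∈ Set.Icc (0:ℝ) T, ∀ l,
      uε ε t l = u0 l + (∫ s in (0:ℝ)..t, β (uε ε s) l)
        + ∑ j', sInt (η j') t (fun s => σ ε (uε ε s) l j'))
    (w : Fin (k + 1) → ℝ → EuclideanSpace ℝ (Fin d))
    (hwm : ∀ j, Measurable (w j))
    (Ku : ℝ) (hwb : ∀ j, ∀ t ∈ Set.Icc (0:ℝ) T, ‖w j t‖ ≤ Ku)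
    (hw : ∀ j : Fin (k + 1), ∀ t ∈ Set.Icc (0:ℝ) T, ∀ l,
      w j t l = (if (j : ℕ) = 0 then u0 l else 0)
        + (∫ s in (0:ℝ)..t, coeffAt k (fun _ x => β x) (fun m => w m s) (j : ℕ) l)
        + ∑ j', sInt (η j') t (fun s => coeffAt k σ (fun m => w m s) (j : ℕ) l j')) :
    -- `R_k(t,ε) := ε^{-(k+1)} (u_ε(t) − Σ_{j=0}^k ε^j u_j(t))`
    let Rk : ℝ → ℝ → EuclideanSpace ℝ (Fin d) := fun ε t =>
      (ε ^ (k + 1))⁻¹ • (uε ε t - ∑ j : Fin (k + 1), ε ^ (j : ℕ) • w j t)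
    ∀ ε ∈ Set.Ioc (0:ℝ) ε₀, ∀ t ∈ Set.Icc (0:ℝ) T, ∀ l,
      Rk ε t l =
        (∫ s in (0:ℝ)..t, remCoeff k (fun _ x => β x) (fun m => w m s) (Rk ε s) ε l)
        + ∑ j', sInt (η j') t (fun s => remCoeff k σ (fun m => w m s) (Rk ε s) ε l j') := by
  intro Rk ε hε t ht l
  have hsub : ∀ s ∈ Set.Icc (0:ℝ) t, s ∈ Set.Icc (0:ℝ) T := fun s hs => ⟨hs.1, hs.2.trans ht.2⟩
  have hvm : Measurable (fun s m => w m s) := measurable_pi_lambda _ hwm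
  have hvb : ∀ s ∈ Set.Icc (0:ℝ) t, ‖fun m => w m s‖ ≤ Ku := fun s hs =>
    (pi_norm_le_iff_of_nonempty _).2 fun m => hwb m s (hsub s hs)
  have hub : ∀ s ∈ Set.Icc (0:ℝ) t, ‖uε ε s‖ ≤ K := fun s hs => huεb ε hε s (hsub s hs)
  have hcβ : ∀ j : Fin (k + 1), ∀ (μ : Measure ℝ) [IsLocallyFiniteMeasure μ], IntegrableOn
      (fun s => coeffAt k (fun _ x => β x) (fun m => w m s) (j : ℕ) l) (Set.Icc 0 t) μ := by
    intro j μ _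
    have h := continuous_coeffAt (k := k) (j := j) (g := fun _ x => β x)
      (hβ.comp contDiff_snd) (by omega)
    exact ((EuclideanSpace.proj l : _ →L[ℝ] ℝ).continuous.comp h).integrableOn_Icc_comp hvm hvb μ
  have hcσ : ∀ j' (j : Fin (k + 1)) (μ : Measure ℝ) [IsFiniteMeasure μ], IntegrableOn
      (fun s => coeffAt k σ (fun m => w m s) (j : ℕ) l j') (Set.Icc 0 t) μ := by
    intro j' j μ _
    have h := continuous_coeffAt (k := k) (j := j) hσ (by omega)
    exact ((continuous_apply_apply l j').comp h).integrableOn_Icc_comp hvm hvb μ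
  have hfβ : IntegrableOn (fun s => β (uε ε s) l) (Set.Icc 0 t) :=
    ((EuclideanSpace.proj l : _ →L[ℝ] ℝ).continuous.comp
      hβ.continuous).integrableOn_Icc_comp (huεm ε hε) hub volume
  have hfσ : ∀ j' (μ : Measure ℝ) [IsFiniteMeasure μ],
      IntegrableOn (fun s => σ ε (uε ε s) l j') (Set.Icc 0 t) μ := fun j' μ _ =>
    ((continuous_apply_apply l j').comp (hσ.continuous.comp
      (Continuous.prodMk_right ε))).integrableOn_Icc_comp (huεm ε hε) hub μ
  have hu0 : ∑ j : Fin (k + 1), ε ^ (j : ℕ) * (if (j : ℕ) = 0 then u0 l else 0) = u0 l := by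
    simp
  simp only [Rk, remCoeff_eq k _ _ _ hε.1.ne', PiLp.smul_apply, PiLp.sub_apply, WithLp.ofLp_sum,
    Finset.sum_apply, Pi.smul_apply, Pi.sub_apply, smul_eq_mul]
  rw [huε ε hε t ht l]
  simp only [hw _ t ht l, intervalIntegral.integral_of_le ht.1, ← integral_Icc_eq_integral_Ioc,
    sInt_mul_sub_sum _ t _ _ (hfσ _) (hcσ _),
    integral_mul_sub_sum _ _ hfβ fun j => hcβ j volume]
  simp only [mul_add, Finset.sum_add_distrib, hu0]
  rw [← Finset.mul_sum, Finset.sum_sub_distrib]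
  simp only [Finset.mul_sum]
  rw [Finset.sum_comm]
  ring
end
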